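/- arXiv:math/0307224 — 4 statements merged into one kernel-verified Lean document; each statement's English description precedes it below -/
import Mathlib

section
/- Let Σ be a flag simplicial complex on [n] and let 1 ≤ ℓ ≤ n−2. Let Δ be the simplicial complex on [n] whose faces are the subsets of [n] containing no (ℓ+1)-element nonface of Σ (so I_Δ = I(\overline{skel_Σ(ℓ)})), and let Δ' be the simplicial complex whose faces are the subsets of [n] containing no 2-element nonface of Σ (so I_{Δ'} = I(\overline{skel_Σ(1)})). Then Δ^∨ = skel_{(Δ')^∨}(n−ℓ−2). -/
open Finset

/-- A simplicial complex on the vertex set `Fin n`: contains all singletons and is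
closed under taking subsets. -/
def IsComplex {n : ℕ} (Δ : Set (Finset (Fin n))) : Prop :=
  (∀ i : Fin n, {i} ∈ Δ) ∧ ∀ F ∈ Δ, ∀ G ⊆ F, G ∈ Δ

/-- Closed under taking subsets (a simplicial complex, singletons not required). -/
def IsLowerComplex {n : ℕ} (Δ : Set (Finset (Fin n))) : Prop :=
  ∀ F ∈ Δ, ∀ G ⊆ F, G ∈ Δ

/-- The set of facets (maximal faces) of `Δ`. -/
def facets {n : ℕ} (Δ : Set (Finset (Fin n))) : Set (Finset (Fin n)) :=
  {F | F ∈ Δ ∧ ∀ G ∈ Δ, F ⊆ G → F = G}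

/-- The simplicial complex generated by a family of subsets of `Fin n`. -/
def gen {n : ℕ} (S : Set (Finset (Fin n))) : Set (Finset (Fin n)) :=
  {G | ∃ F ∈ S, G ⊆ F}

/-- `F` is a leaf of `Δ`: either `F` is the only facet, or there is a facet `G ≠ F`
(a branch of `F`) with `H ∩ F ⊆ G ∩ F` for every facet `H ≠ F`. -/
def IsLeaf {n : ℕ} (Δ : Set (Finset (Fin n))) (F : Finset (Fin n)) : Prop :=
  F ∈ facets Δ ∧
    (facets Δ = {F} ∨ ∃ G ∈ facets Δ, G ≠ F ∧ ∀ H ∈ facets Δ, H ≠ F → H ∩ F ⊆ G ∩ F)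

/-- `Δ` is a quasi-tree: there is a labeling `F₁, …, F_m` of its facets such that `F_i`
is a leaf of `⟨F₁, …, F_i⟩` for every `i` (a leaf order). -/
def IsQuasiTree {n : ℕ} (Δ : Set (Finset (Fin n))) : Prop :=
  ∃ L : List (Finset (Fin n)), L.Nodup ∧ {F | F ∈ L} = facets Δ ∧
    ∀ i : Fin L.length, IsLeaf (gen {F | F ∈ L.take (i.1 + 1)}) (L.get i)

/-- `Δ` is pure: all facets have the same cardinality. -/
def IsPure {n : ℕ} (Δ : Set (Finset (Fin n))) : Prop :=
  ∀ F ∈ facets Δ, ∀ G ∈ facets Δ, F.card = G.card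

/-- `Δ` is shellable: it is pure and there is an order `F₁, …, F_m` of its facets such
that for all `j < i` and `x ∈ F_i \ F_j` there is `k < i` with `F_i \ F_k = {x}`. -/
def IsShellable {n : ℕ} (Δ : Set (Finset (Fin n))) : Prop :=
  IsPure Δ ∧ ∃ L : List (Finset (Fin n)), L.Nodup ∧ {F | F ∈ L} = facets Δ ∧
    ∀ i j : Fin L.length, j < i →
      ∀ x ∈ L.get i \ L.get j, ∃ k : Fin L.length, k < i ∧ L.get i \ L.get k = {x}

/-- The `i`-skeleton of `Δ`: the complex generated by the faces of dimension `i`. -/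
def skel {n : ℕ} (Δ : Set (Finset (Fin n))) (i : ℕ) : Set (Finset (Fin n)) :=
  gen {F | F ∈ Δ ∧ F.card = i + 1}

/-- The Alexander dual of `Δ`: `Δ^∨ = {[n] \ F : F ∉ Δ}`. -/
def dual {n : ℕ} (Δ : Set (Finset (Fin n))) : Set (Finset (Fin n)) :=
  {G | Gᶜ ∉ Δ}

/-- `Δ^c`, the complex generated by the complements of the facets of `Δ`. -/
def complements {n : ℕ} (Δ : Set (Finset (Fin n))) : Set (Finset (Fin n)) :=
  gen ((·ᶜ) '' facets Δ)

/-- `Δ` is flag: every minimal nonface has exactly two elements. -/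
def IsFlag {n : ℕ} (Δ : Set (Finset (Fin n))) : Prop :=
  ∀ F : Finset (Fin n), F ∉ Δ → (∀ G ⊂ F, G ∈ Δ) → F.card = 2

/-- The squarefree monomial `x_F = ∏_{i ∈ F} x_i`. -/
noncomputable def xF {n : ℕ} (K : Type) [Field K] (F : Finset (Fin n)) :
    MvPolynomial (Fin n) K := ∏ i ∈ F, MvPolynomial.X i

/-- The Stanley–Reisner ideal of `Δ`, generated by the monomials `x_F` with `F` a
nonface of `Δ`. -/
noncomputable def SRIdeal {n : ℕ} (K : Type) [Field K] (Δ : Set (Finset (Fin n))) :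
    Ideal (MvPolynomial (Fin n) K) := Ideal.span (xF K '' {F | F ∉ Δ})

/-- The facet ideal of `Δ`, generated by the monomials `x_F` with `F` a facet of `Δ`. -/
noncomputable def facetIdeal {n : ℕ} (K : Type) [Field K] (Δ : Set (Finset (Fin n))) :
    Ideal (MvPolynomial (Fin n) K) := Ideal.span (xF K '' facets Δ)

/-- A set `G` of monomials (assumed to be the minimal monomial generating set of the
ideal it generates) has linear quotients: there is an order `f₁, …, f_m` of `G` such
that each colon ideal `(f₁,…,f_{i-1}) : f_i` is generated by a set of variables. -/
def HasLinearQuotients {n : ℕ} (K : Type) [Field K]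
    (G : Set (MvPolynomial (Fin n) K)) : Prop :=
  ∃ L : List (MvPolynomial (Fin n) K), L.Nodup ∧ {f | f ∈ L} = G ∧
    ∀ i : Fin L.length, 0 < i.1 →
      ∃ V : Set (Fin n),
        Submodule.colon (Ideal.span {f | f ∈ L.take i.1}) (Ideal.span {L.get i}) =
          Ideal.span (MvPolynomial.X '' V)

/-- The clique complex `Δ(G)` of a graph `G`: faces are the cliques of `G`. -/
def cliqueComplex {n : ℕ} (G : SimpleGraph (Fin n)) : Set (Finset (Fin n)) :=
  {F | ∀ i ∈ F, ∀ j ∈ F, i ≠ j → G.Adj i j}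

/-- A graph is chordal if every cycle of length at least 4 has a chord, i.e. an edge of
the graph joining two vertices of the cycle which is not an edge of the cycle. -/
def IsChordalGraph {V : Type} (G : SimpleGraph V) : Prop :=
  ∀ (v : V) (c : G.Walk v v), c.IsCycle → 4 ≤ c.length →
    ∃ x y, G.Adj x y ∧ x ∈ c.support ∧ y ∈ c.support ∧ s(x, y) ∉ c.edges

/-- A module `M` over `S` has projective dimension at most one: some (equivalently, by
Schanuel's lemma, any) presentation of `M` by a free module has projective kernel. -/
def ProjDimLEOne (S : Type) [CommRing S] (M : Type) [AddCommGroup M] [Module S M] : Prop :=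
  ∃ (ι : Type) (f : (ι →₀ S) →ₗ[S] M), Function.Surjective f ∧
    Module.Projective S (LinearMap.ker f)

/-- The monomial with exponent vector `a`. -/
noncomputable def mono {n : ℕ} (K : Type) [Field K] (a : Fin n → ℕ) :
    MvPolynomial (Fin n) K := MvPolynomial.monomial (Finsupp.equivFunOnFinite.symm a) 1

/-- The Taylor relation `r_{ij} = u_{ji} e_i - u_{ij} e_j` for the monomials with
exponent vectors `a i`, `a j`, where `u_{ij} = u_i / gcd(u_i, u_j)`. -/
noncomputable def taylorRel {n t : ℕ} (K : Type) [Field K] (a : Fin t → Fin n → ℕ)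
    (i j : Fin t) : Fin t → MvPolynomial (Fin n) K :=
  Pi.single i (mono K (a j - a i ⊓ a j)) - Pi.single j (mono K (a i - a i ⊓ a j))

/-- In a flag complex every nonface contains a nonface with two elements. -/
theorem IsFlag.exists_card_two {n : ℕ} {Δ : Set (Finset (Fin n))} (hflag : IsFlag Δ)
    {H : Finset (Fin n)} (hH : H ∉ Δ) : ∃ G ⊆ H, G.card = 2 ∧ G ∉ Δ := by
  induction H using Finset.strongInduction with
  | H H ih =>
    by_cases hmin : ∀ G ⊂ H, G ∈ Δ
    · exact ⟨H, Subset.rfl, hflag H hH hmin, hH⟩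
    · push Not at hmin
      obtain ⟨G, hGH, hG⟩ := hmin
      obtain ⟨E, hEG, hE⟩ := ih G hGH hG
      exact ⟨E, hEG.trans hGH.subset, hE⟩

/-- Let `Σ` be a flag complex on `[n]` and `1 ≤ ℓ ≤ n-2`.  If `Δ` is the
complex whose faces are the subsets containing no `(ℓ+1)`-element nonface of `Σ`
(so `I_Δ = I(\overline{skel_Σ(ℓ)})`) and `Δ'` the complex whose faces are the subsets
containing no 2-element nonface of `Σ`, then `Δ^∨ = skel_{(Δ')^∨}(n-ℓ-2)`. -/
theorem stmt_2 {n ℓ : ℕ} (hl1 : 1 ≤ ℓ) (hl2 : ℓ + 2 ≤ n)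
    (Sg Δ Δ' : Set (Finset (Fin n))) (hS : IsLowerComplex Sg) (hflag : IsFlag Sg)
    (hΔ : ∀ F : Finset (Fin n), F ∈ Δ ↔ ∀ G ⊆ F, G.card = ℓ + 1 → G ∈ Sg)
    (hΔ' : ∀ F : Finset (Fin n), F ∈ Δ' ↔ ∀ G ⊆ F, G.card = 2 → G ∈ Sg) :
    dual Δ = skel (dual Δ') (n - ℓ - 2) := by
  ext G
  constructor
  · intro hG
    change Gᶜ ∉ Δ at hG
    rw [hΔ] at hG
    push Not at hG
    obtain ⟨H, hHG, hHcard, hH⟩ := hG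
    refine ⟨Hᶜ, ⟨?_, ?_⟩, subset_compl_comm.mp hHG⟩
    · change Hᶜᶜ ∉ Δ'
      rw [compl_compl, hΔ']
      obtain ⟨E, hEH, hEcard, hE⟩ := hflag.exists_card_two hH
      exact fun h => hE (h E hEH hEcard)
    · rw [card_compl, Fintype.card_fin, hHcard]
      omega
  · rintro ⟨F, ⟨hF, hFcard⟩, hGF⟩
    change Fᶜ ∉ Δ' at hF
    change Gᶜ ∉ Δ
    have hcard : Fᶜ.card = ℓ + 1 := by
      rw [card_compl, Fintype.card_fin, hFcard]
      omega
    rw [hΔ'] at hF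
    rw [hΔ]
    exact fun h => hF fun E hEF _ =>
      hS _ (h Fᶜ (compl_subset_compl.mpr hGF) hcard) E hEF
end

section
/- Let Σ be a flag simplicial complex on [n] and let ℓ ≥ 1. If the ideal generated by the monomials x_i x_j with {i,j} a 2-element nonface of Σ (that is, I(\overline{skel_Σ(1)})) has linear quotients, then the ideal generated by the monomials x_F with F an (ℓ+1)-element nonface of Σ (that is, I(\overline{skel_Σ(ℓ)})) also has linear quotients. -/
open Finset

/-- The exponent vector of the squarefree monomial `x_F`. -/
noncomputable def faceExponent {n : ℕ} (F : Finset (Fin n)) : Fin n →₀ ℕ :=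
  ∑ i ∈ F, Finsupp.single i 1

theorem faceExponent_apply {n : ℕ} (F : Finset (Fin n)) (i : Fin n) :
    faceExponent F i = if i ∈ F then 1 else 0 := by
  simp [faceExponent, Finsupp.finsetSum_apply, Finsupp.single_apply]

theorem xF_eq_monomial {n : ℕ} (K : Type) [Field K] (F : Finset (Fin n)) :
    xF K F = MvPolynomial.monomial (faceExponent F) 1 := by
  rw [faceExponent, MvPolynomial.monomial_sum_one]
  rfl

theorem xF_injective {n : ℕ} (K : Type) [Field K] :
    Function.Injective (xF K : Finset (Fin n) → MvPolynomial (Fin n) K) := by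
  intro F G h
  rw [xF_eq_monomial, xF_eq_monomial] at h
  have h' := MvPolynomial.monomial_left_injective (one_ne_zero : (1 : K) ≠ 0) h
  ext i
  have hi := DFunLike.congr_fun h' i
  rw [faceExponent_apply, faceExponent_apply] at hi
  split_ifs at hi <;> simp_all

theorem xF_dvd_of_subset {n : ℕ} (K : Type) [Field K] {F G : Finset (Fin n)} (h : F ⊆ G) :
    xF K F ∣ xF K G :=
  Finset.prod_dvd_prod_of_subset _ _ _ h

theorem mem_span_xF_image_iff {n : ℕ} (K : Type) [Field K] (T : Set (Finset (Fin n)))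
    (p : MvPolynomial (Fin n) K) :
    p ∈ Ideal.span (xF K '' T) ↔ ∀ m ∈ p.support, ∃ F ∈ T, faceExponent F ≤ m := by
  have h : xF K '' T = (fun s => MvPolynomial.monomial s (1 : K)) '' (faceExponent '' T) := by
    rw [Set.image_image]
    exact Set.image_congr fun F _ => xF_eq_monomial K F
  rw [h, MvPolynomial.mem_ideal_span_monomial_image]
  simp

theorem xF_mem_span_xF_image {n : ℕ} (K : Type) [Field K] {T : Set (Finset (Fin n))}
    {F G : Finset (Fin n)} (hF : F ∈ T) (h : F ⊆ G) : xF K G ∈ Ideal.span (xF K '' T) :=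
  Ideal.mem_of_dvd _ (xF_dvd_of_subset K h) (Ideal.subset_span ⟨F, hF, rfl⟩)

theorem mem_colon_span_singleton {R : Type*} [CommRing R] (I : Ideal R) (f p : R) :
    p ∈ Submodule.colon I (Ideal.span {f}) ↔ p * f ∈ I := by
  rw [Submodule.mem_colon]
  constructor
  · intro h
    exact h f (Ideal.mem_span_singleton_self f)
  · intro h s hs
    obtain ⟨a, rfl⟩ := Ideal.mem_span_singleton'.1 hs
    rw [smul_eq_mul, mul_left_comm]
    exact I.mul_mem_left a h

/-- If a colon ideal of squarefree monomials is generated by variables, then every generator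
`x_B` of the ideal can be exchanged along some variable of `B \ A`. -/
theorem exists_exchange_of_colon_eq {n : ℕ} (K : Type) [Field K] {T : Set (Finset (Fin n))}
    {A : Finset (Fin n)} {V : Set (Fin n)}
    (hV : Submodule.colon (Ideal.span (xF K '' T)) (Ideal.span {xF K A}) =
      Ideal.span (MvPolynomial.X '' V)) {B : Finset (Fin n)} (hB : B ∈ T) :
    ∃ x ∈ B \ A, ∃ C ∈ T, C ⊆ insert x A := by
  have hBA : xF K (B \ A) ∈ Ideal.span (MvPolynomial.X '' V) := by
    rw [← hV, mem_colon_span_singleton, xF, xF, ← Finset.prod_union Finset.sdiff_disjoint,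
      Finset.sdiff_union_self_eq_union]
    exact xF_mem_span_xF_image K hB Finset.subset_union_left
  rw [MvPolynomial.mem_ideal_span_X_image, xF_eq_monomial] at hBA
  obtain ⟨x, hxV, hx⟩ := hBA (faceExponent (B \ A)) (by simp)
  have hxBA : x ∈ B \ A := by
    by_contra h
    exact hx (by rw [faceExponent_apply, if_neg h])
  refine ⟨x, hxBA, ?_⟩
  have hX : (MvPolynomial.X x : MvPolynomial (Fin n) K) ∈
      Submodule.colon (Ideal.span (xF K '' T)) (Ideal.span {xF K A}) := by
    rw [hV]
    exact Ideal.subset_span ⟨x, hxV, rfl⟩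
  have hins : MvPolynomial.X x * xF K A = xF K (insert x A) :=
    (Finset.prod_insert (Finset.mem_sdiff.1 hxBA).2).symm
  rw [mem_colon_span_singleton, hins, mem_span_xF_image_iff, xF_eq_monomial] at hX
  obtain ⟨C, hC, hCle⟩ := hX (faceExponent (insert x A))
    (by simp)
  refine ⟨C, hC, fun i hi => ?_⟩
  by_contra h
  have := hCle i
  simp [faceExponent_apply, hi, h] at this

/-- Squarefree monomials with the exchange property have a colon ideal generated by
variables. -/
theorem exists_colon_eq_of_exchange {n : ℕ} (K : Type) [Field K] {T : Set (Finset (Fin n))}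
    {A : Finset (Fin n)} (h : ∀ B ∈ T, ∃ x ∈ B \ A, ∃ C ∈ T, C ⊆ insert x A) :
    ∃ V : Set (Fin n), Submodule.colon (Ideal.span (xF K '' T)) (Ideal.span {xF K A}) =
      Ideal.span (MvPolynomial.X '' V) := by
  refine ⟨{x | x ∉ A ∧ ∃ C ∈ T, C ⊆ insert x A}, le_antisymm ?_ ?_⟩
  · intro p hp
    rw [mem_colon_span_singleton, mem_span_xF_image_iff, xF_eq_monomial] at hp
    rw [MvPolynomial.mem_ideal_span_X_image]
    intro m hm
    obtain ⟨B, hB, hle⟩ := hp (m + faceExponent A) (by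
      rw [MvPolynomial.mem_support_iff, MvPolynomial.coeff_mul_monomial, mul_one]
      exact MvPolynomial.mem_support_iff.1 hm)
    obtain ⟨x, hx, hC⟩ := h B hB
    rw [Finset.mem_sdiff] at hx
    refine ⟨x, ⟨hx.2, hC⟩, fun h0 => ?_⟩
    have := hle x
    simp [faceExponent_apply, hx.1, hx.2, h0] at this
  · rw [Ideal.span_le]
    rintro _ ⟨x, ⟨hxA, C, hC, hCx⟩, rfl⟩
    have hins : MvPolynomial.X x * xF K A = xF K (insert x A) := (Finset.prod_insert hxA).symm
    rw [SetLike.mem_coe, mem_colon_span_singleton, hins]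
    exact xF_mem_span_xF_image K hC hCx

/-- Linear quotients of squarefree monomials yield a ranking with the exchange property. -/
theorem HasLinearQuotients.exists_rank {n : ℕ} {K : Type} [Field K]
    {T : Set (Finset (Fin n))} (h : HasLinearQuotients K (xF K '' T)) :
    ∃ r : Finset (Fin n) → ℕ, Set.InjOn r T ∧ ∀ A ∈ T, ∀ B ∈ T, r B < r A →
      ∃ x ∈ B \ A, ∃ C ∈ T, r C < r A ∧ C ⊆ insert x A := by
  classical
  obtain ⟨L, -, hLT, hL⟩ := h
  have hmem : ∀ A ∈ T, xF K A ∈ L := fun A hA => by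
    have : xF K A ∈ {f | f ∈ L} := hLT ▸ ⟨A, hA, rfl⟩
    exact this
  refine ⟨fun A => L.idxOf (xF K A), fun A hA B _ hAB =>
    xF_injective K ((List.idxOf_inj (hmem A hA)).1 hAB), fun A hA B hB hBA => ?_⟩
  have htake : {f | f ∈ L.take (L.idxOf (xF K A))} =
      xF K '' {C | C ∈ T ∧ L.idxOf (xF K C) < L.idxOf (xF K A)} := by
    ext f
    constructor
    · intro hf
      have hfT : f ∈ xF K '' T := hLT ▸ List.mem_of_mem_take hf
      obtain ⟨C, hC, rfl⟩ := hfT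
      exact ⟨C, ⟨hC, (List.mem_take_iff_idxOf_lt (hmem C hC)).1 hf⟩, rfl⟩
    · rintro ⟨C, ⟨hC, hlt⟩, rfl⟩
      exact List.mem_take_iff_getElem.2 ⟨_, lt_min hlt (List.idxOf_lt_length_of_mem (hmem C hC)),
        List.getElem_idxOf _⟩
  obtain ⟨V, hV⟩ := hL ⟨L.idxOf (xF K A), List.idxOf_lt_length_of_mem (hmem A hA)⟩
    (Nat.zero_lt_of_lt hBA)
  simp only [List.get_eq_getElem, List.getElem_idxOf] at hV
  rw [htake] at hV
  obtain ⟨x, hx, C, hC, hCx⟩ := exists_exchange_of_colon_eq K hV (B := B) ⟨hB, hBA⟩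
  exact ⟨x, hx, C, hC.1, hC.2, hCx⟩

/-- A ranking with the exchange property, ties being resolved arbitrarily, yields linear
quotients. -/
theorem hasLinearQuotients_of_rank {n : ℕ} (K : Type) [Field K] {α : Type*} [LinearOrder α]
    (T : Set (Finset (Fin n))) (r : Finset (Fin n) → α)
    (h : ∀ A ∈ T, ∀ B ∈ T, B ≠ A → r B ≤ r A →
      ∃ x ∈ B \ A, ∃ C ∈ T, r C < r A ∧ C ⊆ insert x A) :
    HasLinearQuotients K (xF K '' T) := by
  let M := T.toFinite.toFinset.toList.insertionSort (r · ≤ r ·)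
  have hperm : M.Perm T.toFinite.toFinset.toList := List.perm_insertionSort _ _
  have hmem : ∀ A, A ∈ M ↔ A ∈ T := fun A => by simp [hperm.mem_iff]
  have hnodup : M.Nodup := hperm.nodup_iff.2 (Finset.nodup_toList _)
  have : Std.Total (fun A B : Finset (Fin n) => r A ≤ r B) := ⟨fun A B => le_total _ _⟩
  have : IsTrans (Finset (Fin n)) (fun A B => r A ≤ r B) := ⟨fun A B C => le_trans⟩
  have hsorted : M.Pairwise (r · ≤ r ·) := List.pairwise_insertionSort _ _
  refine ⟨M.map (xF K), hnodup.map (xF_injective K), ?_, ?_⟩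
  · ext f
    simp [hmem]
  · rintro ⟨i, hi⟩ -
    rw [List.length_map] at hi
    have htake : {f | f ∈ (M.map (xF K)).take i} = xF K '' {C | C ∈ M.take i} := by
      ext f
      simp [← List.map_take]
    simp only [List.get_eq_getElem, List.getElem_map]
    rw [htake]
    refine exists_colon_eq_of_exchange K fun B hB => ?_
    obtain ⟨j, hj, rfl⟩ := List.mem_take_iff_getElem.1 hB
    rw [lt_min_iff] at hj
    obtain ⟨x, hx, C, hC, hlt, hCx⟩ := h M[i] ((hmem _).1 (List.getElem_mem _)) M[j]
      ((hmem _).1 (List.getElem_mem _)) (fun he => hj.1.ne ((hnodup.getElem_inj_iff).1 he))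
      (List.pairwise_iff_getElem.1 hsorted j i hj.2 hi hj.1)
    obtain ⟨k, hk, rfl⟩ := List.mem_iff_getElem.1 ((hmem C).2 hC)
    refine ⟨x, hx, M[k], List.mem_take_iff_getElem.2 ⟨k, lt_min ?_ hk, rfl⟩, hCx⟩
    by_contra! hik
    rcases hik.eq_or_lt with rfl | hik
    · exact hlt.false
    · exact (List.pairwise_iff_getElem.1 hsorted i k hi hk hik).not_gt hlt

/-- Every nonface of a flag complex contains a nonface with two elements. -/
theorem IsFlag.exists_subset_card_eq_two {n : ℕ} {Δ : Set (Finset (Fin n))} (h : IsFlag Δ)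
    (F : Finset (Fin n)) (hF : F ∉ Δ) : ∃ G ⊆ F, G.card = 2 ∧ G ∉ Δ := by
  induction F using Finset.strongInduction with
  | H F ih =>
    by_cases hmin : ∀ G ⊂ F, G ∈ Δ
    · exact ⟨F, subset_rfl, h F hF hmin, hF⟩
    · push Not at hmin
      obtain ⟨G, hGF, hG⟩ := hmin
      obtain ⟨H, hHG, hH⟩ := ih G hGF hG
      exact ⟨H, hHG.trans hGF.subset, hH⟩

/-- Two distinct sets of the same size admit a swap decreasing the one of larger sum. -/
theorem exists_lt_of_sum_le {n : ℕ} {A B : Finset (Fin n)} (hcard : B.card = A.card)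
    (hne : B ≠ A) (hsum : ∑ i ∈ B, i.val ≤ ∑ i ∈ A, i.val) :
    ∃ x ∈ B \ A, ∃ y ∈ A \ B, x < y := by
  by_contra! hle
  have hc : (B \ A).card = (A \ B).card := Finset.card_sdiff_comm hcard
  have hBA : (B \ A).Nonempty := by
    rw [Finset.sdiff_nonempty]
    exact fun hs => hne (Finset.eq_of_subset_of_card_le hs hcard.ge)
  have hsum' : ∑ i ∈ B \ A, i.val ≤ ∑ i ∈ A \ B, i.val :=
    (Finset.sum_sdiff_le_sum_sdiff).2 hsum
  obtain ⟨x, hx, hxmin⟩ := Finset.exists_min_image (B \ A) Fin.val hBA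
  have hlt : ∀ y ∈ A \ B, y.val < x.val := fun y hy =>
    lt_of_le_of_ne (hle x hx y hy) fun he =>
      (Finset.mem_sdiff.1 hx).2 (Fin.ext he ▸ (Finset.mem_sdiff.1 hy).1)
  have hAB : (A \ B).Nonempty := Finset.card_pos.1 (hc ▸ hBA.card_pos)
  have h1 : ∑ i ∈ A \ B, i.val < ∑ _i ∈ A \ B, x.val := Finset.sum_lt_sum_of_nonempty hAB hlt
  have h2 := Finset.card_nsmul_le_sum (B \ A) Fin.val x.val hxmin
  rw [Finset.sum_const, ← hc] at h1
  exact (h1.trans_le h2).not_ge hsum'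

/-- Let `Σ` be a flag complex on `[n]` and `ℓ ≥ 1`.  If the ideal
`I(\overline{skel_Σ(1)})`, generated by the monomials `x_F` with `F` a 2-element
nonface of `Σ`, has linear quotients, then so does `I(\overline{skel_Σ(ℓ)})`, generated
by the monomials `x_F` with `F` an `(ℓ+1)`-element nonface of `Σ`. -/
theorem stmt_4 {n ℓ : ℕ} (hl : 1 ≤ ℓ) (K : Type) [Field K]
    (Sg : Set (Finset (Fin n))) (hS : IsComplex Sg) (hflag : IsFlag Sg)
    (h1 : HasLinearQuotients K (xF K '' {F : Finset (Fin n) | F.card = 2 ∧ F ∉ Sg})) :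
    HasLinearQuotients K (xF K '' {F : Finset (Fin n) | F.card = ℓ + 1 ∧ F ∉ Sg}) := by
  obtain ⟨r, hinj, hr⟩ := h1.exists_rank
  set T₂ := {F : Finset (Fin n) | F.card = 2 ∧ F ∉ Sg}
  let m : Finset (Fin n) → ℕ := fun F => sInf (r '' {A | A ∈ T₂ ∧ A ⊆ F})
  have hm_le : ∀ F, ∀ A ∈ T₂, A ⊆ F → m F ≤ r A := fun F A hA hAF =>
    Nat.sInf_le ⟨A, ⟨hA, hAF⟩, rfl⟩
  have hm_mem : ∀ F ∉ Sg, ∃ A ∈ T₂, A ⊆ F ∧ r A = m F := by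
    intro F hF
    obtain ⟨G, hGF, hG⟩ := hflag.exists_subset_card_eq_two F hF
    obtain ⟨A, ⟨hA, hAF⟩, hrA⟩ := Nat.sInf_mem
      (s := r '' {A | A ∈ T₂ ∧ A ⊆ F}) ⟨r G, G, ⟨hG, hGF⟩, rfl⟩
    exact ⟨A, hA, hAF, hrA⟩
  refine hasLinearQuotients_of_rank K _ (fun F => toLex (m F, ∑ i ∈ F, i.val)) ?_
  rintro A ⟨hAc, hA⟩ B ⟨hBc, hB⟩ hne hle
  simp only [Prod.Lex.toLex_le_toLex] at hle
  simp only [Prod.Lex.toLex_lt_toLex]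
  obtain ⟨a, ha, haA, hra⟩ := hm_mem A hA
  obtain ⟨b, hb, hbB, hrb⟩ := hm_mem B hB
  rcases hle with hlt | ⟨heq, hsum⟩
  · obtain ⟨x, hx, c, hc, hrc, hca⟩ := hr a ha b hb (by omega)
    rw [Finset.mem_sdiff] at hx
    have hxA : x ∉ A := fun hxA => by
      have := hm_le A c hc (hca.trans (Finset.insert_subset hxA haA))
      omega
    obtain ⟨C, hcC, hCA, hCc⟩ := Finset.exists_subsuperset_card_eq
      (hca.trans (Finset.insert_subset_insert x haA)) (n := ℓ + 1) (by rw [hc.1]; omega)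
      (by rw [Finset.card_insert_of_notMem hxA]; omega)
    have := hm_le C c hc hcC
    exact ⟨x, Finset.mem_sdiff.2 ⟨hbB hx.1, hxA⟩, C, ⟨hCc, fun hC => hc.2 (hS.2 C hC c hcC)⟩,
      Or.inl (by omega), hCA⟩
  · obtain rfl : a = b := hinj ha hb (by omega)
    obtain ⟨x, hx, y, hy, hxy⟩ := exists_lt_of_sum_le (hBc.trans hAc.symm) hne hsum
    have hx' := Finset.mem_sdiff.1 hx
    have hy' := Finset.mem_sdiff.1 hy
    have hxe : x ∉ A.erase y := fun h => hx'.2 (Finset.mem_of_mem_erase h)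
    have haC : a ⊆ insert x (A.erase y) := fun i hi => Finset.mem_insert_of_mem
      (Finset.mem_erase.2 ⟨fun hiy => hy'.2 (hiy ▸ hbB hi), haA hi⟩)
    have hsumC : ∑ i ∈ insert x (A.erase y), i.val < ∑ i ∈ A, i.val := by
      rw [Finset.sum_insert hxe, ← Finset.add_sum_erase A _ hy'.1]
      exact Nat.add_lt_add_right hxy _
    refine ⟨x, hx, insert x (A.erase y), ⟨?_, fun hC => ha.2 (hS.2 _ hC a haC)⟩, ?_,
      Finset.insert_subset_insert x (Finset.erase_subset y A)⟩
    · rw [Finset.card_insert_of_notMem hxe, Finset.card_erase_add_one hy'.1, hAc]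
    · have := hm_le _ a ha haC
      rcases (this.trans hra.le).lt_or_eq with h | h
      · exact Or.inl h
      · exact Or.inr ⟨h, hsumC⟩
end

section
/- Let Δ be a shellable simplicial complex of dimension d−1. Then for each 1 ≤ i ≤ d−1, the i-skeleton skel_Δ(i) of Δ is shellable. -/
open Finset

/-- The elements of a finite set can be listed in decreasing order of an injective key. -/
lemma exists_list_decreasing {α β : Type*} [LinearOrder β] (S : Finset α) (key : α → β)
    (hkey : Function.Injective key) :
    ∃ L : List α, L.Nodup ∧ (∀ a, a ∈ L ↔ a ∈ S) ∧
      ∀ i j : Fin L.length, j < i ↔ key (L.get i) < key (L.get j) := by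
  let _ : LinearOrder α := LinearOrder.lift' key hkey
  have hanti : StrictAnti (S.sort (· ≥ ·)).get := S.sortedGT_sort.strictAnti_get
  exact ⟨S.sort (· ≥ ·), S.sort_nodup _, fun a => S.mem_sort _,
    fun i j => hanti.lt_iff_gt.symm⟩

/-- A family of finite sets with the following exchange property can be put in a shelling order:
each element `x` of a member `G` can be replaced by some larger `y ∉ G`, unless `G` contains
everything above `x`. The order is the decreasing colexicographic one. -/
lemma exists_shelling_of_exchange {V β : Type*} [DecidableEq V] [LinearOrder β]
    (S : Finset (Finset V)) (e : V → β) (he : Function.Injective e)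
    (hex : ∀ G ∈ S, ∀ x ∈ G, (∃ y ∉ G, e x < e y ∧ insert y (G.erase x) ∈ S) ∨
      ∀ y, e x ≤ e y → y ∈ G) :
    ∃ L : List (Finset V), L.Nodup ∧ (∀ G, G ∈ L ↔ G ∈ S) ∧
      ∀ i j : Fin L.length, j < i →
        ∀ x ∈ L.get i \ L.get j, ∃ k : Fin L.length, k < i ∧ L.get i \ L.get k = {x} := by
  let key : Finset V → Colex (Finset β) := fun G => toColex (G.map ⟨e, he⟩)
  have hkey : Function.Injective key := fun G H h =>
    Finset.map_injective ⟨e, he⟩ (toColex.injective h)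
  have key_lt : ∀ {G H : Finset V}, key G < key H ↔
      ∃ z ∈ H, z ∉ G ∧ ∀ w ∈ G, w ∉ H → e w < e z := by
    intro G H
    simp [key, Finset.Colex.toColex_lt_toColex_iff_exists_forall_lt, he.eq_iff]
  obtain ⟨L, hnd, hmem, hlt⟩ := exists_list_decreasing S key hkey
  refine ⟨L, hnd, hmem, fun i j hji x hx => ?_⟩
  rw [Finset.mem_sdiff] at hx
  rcases hex _ ((hmem _).1 (L.get_mem i)) x hx.1 with ⟨y, hyG, hxy, hS⟩ | hall
  · obtain ⟨k, hk⟩ := List.get_of_mem ((hmem _).2 hS)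
    refine ⟨k, (hlt i k).2 ?_, ?_⟩
    · rw [hk, key_lt]
      grind
    · rw [hk]
      ext w
      grind
  · obtain ⟨z, hzj, hzi, hz⟩ := key_lt.1 ((hlt i j).1 hji)
    exact absurd (hall z (hz x hx.1 hx.2).le) hzi

lemma exists_facet_superset {n : ℕ} {Δ : Set (Finset (Fin n))} {G : Finset (Fin n)}
    (hG : G ∈ Δ) : ∃ F ∈ facets Δ, G ⊆ F := by
  obtain ⟨F, hGF, hF⟩ := Set.Finite.exists_le_maximal (Set.toFinite Δ) hG
  exact ⟨F, ⟨hF.prop, fun H hH hFH => hF.eq_of_le hH hFH⟩, hGF⟩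

lemma facets_gen {n s : ℕ} {S : Set (Finset (Fin n))} (hS : ∀ F ∈ S, F.card = s) :
    facets (gen S) = S := by
  ext F
  constructor
  · rintro ⟨⟨H, hH, hFH⟩, hmax⟩
    rwa [hmax H ⟨H, hH, subset_rfl⟩ hFH]
  · intro hF
    refine ⟨⟨F, hF, subset_rfl⟩, ?_⟩
    rintro G ⟨H, hH, hGH⟩ hFG
    refine Finset.eq_of_subset_of_card_le hFG ?_
    rw [hS F hF, ← hS H hH]
    exact Finset.card_le_card hGH

/-- The number of initial members of `L` that contain `v`. -/
def level {V : Type*} [DecidableEq V] (L : List (Finset V)) (v : V) : ℕ :=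
  L.findIdx fun F => decide (v ∉ F)

section Level

variable {V : Type*} [DecidableEq V] {L : List (Finset V)} {v : V}

lemma mem_get_of_lt_level {i : Fin L.length} (h : i.1 < level L v) : v ∈ L.get i := by
  have := List.not_of_lt_findIdx h
  simpa using this

lemma level_le_of_notMem {i : Fin L.length} (h : v ∉ L.get i) : level L v ≤ i :=
  not_lt.1 fun hlt => h (mem_get_of_lt_level hlt)

lemma exists_notMem_of_level_le {i : Fin L.length} (h : level L v ≤ i) :
    ∃ j ≤ i, v ∉ L.get j := by
  have hlt : level L v < L.length := h.trans_lt i.2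
  have := List.findIdx_getElem (w := hlt)
  exact ⟨⟨level L v, hlt⟩, h, by simpa [level] using this⟩

variable {d : ℕ} (hcard : ∀ F ∈ L, F.card = d)
  (hshell : ∀ i j : Fin L.length, j < i →
    ∀ x ∈ L.get i \ L.get j, ∃ k : Fin L.length, k < i ∧ L.get i \ L.get k = {x})

include hshell in
/-- A vertex of a facet in a shelling either lies in all previous facets, or can be removed from
the facet by passing to a previous one. -/
lemma exists_sdiff_eq_singleton {i : Fin L.length} (hv : v ∈ L.get i) (h : level L v ≤ i) :
    ∃ k < i, L.get i \ L.get k = {v} := by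
  obtain ⟨j, hji, hj⟩ := exists_notMem_of_level_le h
  have hne : j ≠ i := by
    rintro rfl
    exact hj hv
  exact hshell i j (lt_of_le_of_ne hji hne) v (Finset.mem_sdiff.2 ⟨hv, hj⟩)

include hcard hshell in
lemma level_exchange {G : Finset V} (hG : ∃ i, G ⊆ L.get i) {x : V} (hx : x ∈ G) :
    (∃ y ∉ G, level L x < level L y ∧ ∃ i, insert y (G.erase x) ⊆ L.get i) ∨
      ∃ i, G ⊆ L.get i ∧ ∀ y, level L x ≤ level L y → y ∈ L.get i := by
  obtain ⟨i, hi, hmin⟩ := WellFounded.has_min (wellFounded_lt (α := Fin L.length))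
    {i | G ⊆ L.get i} hG
  by_cases hxi : i.1 < level L x
  · exact .inr ⟨i, hi, fun y hy => mem_get_of_lt_level (hxi.trans_le hy)⟩
  obtain ⟨k₀, hk₀i, hk₀⟩ := exists_sdiff_eq_singleton hshell (hi hx) (not_lt.1 hxi)
  have hk₀G : G.erase x ⊆ L.get k₀ := by
    intro w hw
    by_contra hwk
    have : w ∈ L.get i \ L.get k₀ :=
      Finset.mem_sdiff.2 ⟨hi (Finset.mem_of_mem_erase hw), hwk⟩
    rw [hk₀, Finset.mem_singleton] at this
    exact Finset.ne_of_mem_erase hw this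
  obtain ⟨k, hk, hkmin⟩ := WellFounded.has_min (wellFounded_lt (α := Fin L.length))
    {k | G.erase x ⊆ L.get k} ⟨k₀, hk₀G⟩
  have hki : k < i := (not_lt.1 (hkmin k₀ hk₀G)).trans_lt hk₀i
  have hxk : x ∉ L.get k := fun hxk => hmin k
    (by
      rw [Set.mem_ofPred_eq, ← Finset.insert_erase hx]
      exact Finset.insert_subset hxk hk) hki
  have hlt : (G.erase x).card < (L.get k).card := by
    rw [hcard _ (L.get_mem k), ← hcard _ (L.get_mem i)]
    exact (Finset.card_erase_lt_of_mem hx).trans_le (Finset.card_le_card hi)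
  obtain ⟨y, hyk, hyG⟩ := Finset.exists_mem_notMem_of_card_lt_card hlt
  have hyx : y ≠ x := by
    rintro rfl
    exact hxk hyk
  refine .inl ⟨y, fun h => hyG (Finset.mem_erase.2 ⟨hyx, h⟩), ?_, k,
    Finset.insert_subset hyk hk⟩
  refine (level_le_of_notMem hxk).trans_lt (not_le.1 fun hyl => ?_)
  obtain ⟨l, hlk, hl⟩ := exists_sdiff_eq_singleton hshell hyk hyl
  refine hkmin l (fun w hw => ?_) hlk
  by_contra hwl
  have : w ∈ L.get k \ L.get l := Finset.mem_sdiff.2 ⟨hk hw, hwl⟩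
  rw [hl, Finset.mem_singleton] at this
  exact hyG (this ▸ hw)

end Level

/-- If `Δ` is a shellable simplicial complex of dimension `d-1`, then for
each `1 ≤ i ≤ d-1` the `i`-skeleton of `Δ` is shellable. -/
theorem stmt_5 {n d : ℕ} (Δ : Set (Finset (Fin n))) (hΔ : IsComplex Δ)
    (hdim : ∀ F ∈ Δ, F.card ≤ d) (hdim' : ∃ F ∈ Δ, F.card = d)
    (hsh : IsShellable Δ) (i : ℕ) (hi1 : 1 ≤ i) (hi2 : i + 1 ≤ d) :
    IsShellable (skel Δ i) := by
  classical
  obtain ⟨hpure, L, -, hL, hshell⟩ := hsh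
  have hLmem : ∀ F, F ∈ L ↔ F ∈ facets Δ := fun F => Set.ext_iff.1 hL F
  have hfacets : facets (skel Δ i) = {F | F ∈ Δ ∧ F.card = i + 1} :=
    facets_gen fun F hF => hF.2
  obtain ⟨m, hm⟩ : ∃ m, ∀ F ∈ L, F.card = m := by
    obtain ⟨F, hF, -⟩ := hdim'
    obtain ⟨F₀, hF₀, -⟩ := exists_facet_superset hF
    exact ⟨F₀.card, fun F hF => hpure F ((hLmem F).1 hF) F₀ hF₀⟩
  have mem_iff : ∀ G, G ∈ Δ ↔ ∃ j, G ⊆ L.get j := by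
    intro G
    constructor
    · intro hG
      obtain ⟨F, hF, hGF⟩ := exists_facet_superset hG
      obtain ⟨j, rfl⟩ := List.get_of_mem ((hLmem F).2 hF)
      exact ⟨j, hGF⟩
    · rintro ⟨j, hj⟩
      exact hΔ.2 _ ((hLmem _).1 (L.get_mem j)).1 G hj
  refine ⟨fun F hF G hG => ?_, ?_⟩
  · rw [hfacets] at hF hG
    exact hF.2.trans hG.2.symm
  let e : Fin n → ℕ ×ₗ Fin n := fun v => toLex (level L v, v)
  have he : Function.Injective e := fun v w h => congrArg Prod.snd (toLex.injective h)
  have level_le : ∀ {v w}, e v ≤ e w → level L v ≤ level L w := by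
    intro v w h
    rcases Prod.Lex.toLex_le_toLex.1 h with h | h
    · exact h.le
    · exact h.1.le
  obtain ⟨M, hnd, hM, hMshell⟩ := exists_shelling_of_exchange
    (univ.filter fun F => F ∈ Δ ∧ F.card = i + 1) e he (by
      intro G hG x hx
      simp only [mem_filter, mem_univ, true_and] at hG ⊢
      have hcard : ∀ y ∉ G, (insert y (G.erase x)).card = i + 1 := by
        intro y hy
        rw [card_insert_of_notMem fun h => hy (mem_of_mem_erase h),
          card_erase_add_one hx, hG.2]
      by_cases hall : ∀ y, e x ≤ e y → y ∈ G
      · exact .inr hall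
      left
      rcases level_exchange hm hshell ((mem_iff G).1 hG.1) hx with
        ⟨y, hy, hxy, hins⟩ | ⟨j, hGj, hj⟩
      · exact ⟨y, hy, Prod.Lex.toLex_lt_toLex.2 (.inl hxy), (mem_iff _).2 hins, hcard y hy⟩
      · push Not at hall
        obtain ⟨y, hxy, hy⟩ := hall
        have hne : e x ≠ e y := fun h => hy (he h ▸ hx)
        exact ⟨y, hy, lt_of_le_of_ne hxy hne, (mem_iff _).2 ⟨j, insert_subset
          (hj y (level_le hxy)) ((erase_subset x G).trans hGj)⟩, hcard y hy⟩)
  refine ⟨M, hnd, ?_, fun a b hba x hx => ?_⟩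
  · rw [hfacets]
    ext F
    simpa using hM F
  · convert hMshell a b hba x (by convert hx)
end

section
/- Let G be a finite simple graph on [n]. Then the clique complex Δ(G) is a quasi-tree if and only if G is a chordal graph. -/
open Finset

namespace SimpleGraph

variable {V : Type} {G : SimpleGraph V}

/-- The edge after `s(x, y)` on a cycle of length at least four leads to a vertex `z` that the
cycle does not join to `x`. -/
lemma Walk.IsCycle.exists_next_edge {v : V} {c : G.Walk v v} (hc : c.IsCycle)
    (hlen : 4 ≤ c.length) {x y : V} (hxy : s(x, y) ∈ c.edges) :
    ∃ z, s(y, z) ∈ c.edges ∧ z ≠ x ∧ s(x, z) ∉ c.edges := by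
  classical
  have start : ∀ {x : V} (d : G.Walk x x), d.IsCycle → 4 ≤ d.length →
      ∃ z, s(d.getVert 1, z) ∈ d.edges ∧ z ≠ x ∧ s(x, z) ∉ d.edges := by
    intro x d hd hl
    have inj := hd.getVert_injOn
    have inj' := hd.getVert_injOn'
    have h0 : d.getVert 0 = x := d.getVert_zero
    have hm : d.getVert d.length = x := d.getVert_length
    have h2 : d.getVert 2 ≠ d.getVert 0 := fun h => by
      have := inj' (by simp; omega) (by simp) h
      omega
    refine ⟨d.getVert 2, ?_, by rwa [h0] at h2, ?_⟩
    · exact d.mk_mem_edges_iff_exists.2 ⟨1, by omega, rfl⟩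
    · rw [Walk.mk_mem_edges_iff_exists]
      rintro ⟨k, hk, h⟩
      rcases Sym2.eq_iff.1 h with ⟨h, h'⟩ | ⟨h, h'⟩
      · have := inj' (x₁ := k) (x₂ := 0) (by simp; omega) (by simp) (by rw [h, h0])
        subst this
        have := inj (x₁ := 0 + 1) (x₂ := 2) (by simp; omega) (by simp; omega) h'
        omega
      · have h1 := inj (x₁ := k + 1) (x₂ := d.length) (by simp; omega) (by simp; omega)
          (by rw [h', hm])
        have := inj' (x₁ := k) (x₂ := 2) (by simp; omega) (by simp; omega) h
        omega
  have hx : x ∈ c.support := c.fst_mem_support_of_mem_edges hxy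
  have hedge : ∀ e, e ∈ (c.rotate x hx).edges ↔ e ∈ c.edges := fun e =>
    (c.rotate_edges x hx).mem_iff
  have hlen' : (c.rotate x hx).length = c.length := by
    rw [← Walk.length_edges, (c.rotate_edges x hx).perm.length_eq, Walk.length_edges]
  have hrot : (c.rotate x hx).IsCycle := hc.rotate hx
  simp only [← hedge] at hxy ⊢
  rw [← hlen'] at hlen
  generalize c.rotate x hx = d at *
  obtain ⟨k, hk, h⟩ := d.mk_mem_edges_iff_exists.1 hxy
  rcases Sym2.eq_iff.1 h with ⟨h, h'⟩ | ⟨h, h'⟩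
  · have := hrot.getVert_injOn' (x₁ := k) (x₂ := 0) (by simp; omega) (by simp) (by simp [h])
    subst this
    rw [← h']
    exact start d hrot hlen
  · have := hrot.getVert_injOn (x₁ := k + 1) (x₂ := d.length) (by simp; omega) (by simp; omega)
      (by simp [h'])
    have hy : d.reverse.getVert 1 = y := by
      rw [Walk.getVert_reverse, ← h]
      congr 1
      omega
    simpa [hy] using start d.reverse hrot.reverse (by simpa using hlen)

/-- A walk inside `T` can be replaced by a chordless path inside `T`. -/
lemma Walk.exists_chordless_path {x y : V} {T : Set V} (q : G.Walk x y)
    (hq : ∀ z ∈ q.support, z ∈ T) :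
    ∃ p : G.Walk x y, p.IsPath ∧ (∀ z ∈ p.support, z ∈ T) ∧
      ∀ a ∈ p.support, ∀ b ∈ p.support, G.Adj a b → s(a, b) ∈ p.edges := by
  classical
  have hex : ∃ k, ∃ p : G.Walk x y, (∀ z ∈ p.support, z ∈ T) ∧ p.length = k := ⟨_, q, hq, rfl⟩
  obtain ⟨p₀, hp₀T, hp₀⟩ := Nat.find_spec hex
  have hmin : ∀ r : G.Walk x y, (∀ z ∈ r.support, z ∈ T) → p₀.length ≤ r.length := by
    intro r hr
    rw [hp₀]
    exact Nat.find_min' hex ⟨r, hr, rfl⟩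
  have hT : ∀ z ∈ p₀.bypass.support, z ∈ T := fun z hz =>
    hp₀T z (p₀.support_bypass_subset_support hz)
  refine ⟨p₀.bypass, p₀.bypass_isPath, hT, ?_⟩
  replace hmin : ∀ r : G.Walk x y, (∀ z ∈ r.support, z ∈ T) → p₀.bypass.length ≤ r.length :=
    fun r hr => p₀.length_bypass_le_length.trans (hmin r hr)
  generalize p₀.bypass = p at *
  have key : ∀ {a b : V} (p₁ : G.Walk x a) (r : G.Walk a b) (p₂ : G.Walk b y), G.Adj a b →
      p = p₁.append (r.append p₂) → s(a, b) ∈ p.edges := by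
    intro a b p₁ r p₂ hab hp
    have h := hmin (p₁.append (Walk.cons hab p₂)) (by
      intro z hz
      apply hT
      rw [hp]
      simp only [Walk.mem_support_append_iff, Walk.support_cons, List.mem_cons] at hz ⊢
      rcases hz with hz | rfl | hz
      · exact .inl hz
      · exact .inl p₁.end_mem_support
      · exact .inr (.inr hz))
    rw [hp] at h ⊢
    simp only [Walk.length_append, Walk.length_cons] at h
    cases r with
    | nil => exact (hab.ne rfl).elim
    | cons h' r' =>
      cases r' with
      | nil => simp
      | cons h'' r'' => simp only [Walk.length_cons] at h; omega
  intro a ha b hb hab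
  have hb' := hb
  rw [← p.take_spec ha, Walk.mem_support_append_iff] at hb'
  rcases hb' with hb' | hb'
  · rw [Sym2.eq_swap]
    refine key ((p.takeUntil a ha).takeUntil b hb') ((p.takeUntil a ha).dropUntil b hb')
      (p.dropUntil a ha) hab.symm ?_
    rw [Walk.append_assoc, Walk.take_spec, Walk.take_spec]
  · refine key (p.takeUntil a ha) ((p.dropUntil a ha).takeUntil b hb')
      ((p.dropUntil a ha).dropUntil b hb') hab ?_
    rw [Walk.take_spec, Walk.take_spec]

end SimpleGraph

open SimpleGraph

/-- In a chordal graph, neighbours of `u` that are connected by a walk whose interior avoids the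
closed neighbourhood of `u` are adjacent. -/
lemma IsChordalGraph.adj_of_walk {V : Type} {G : SimpleGraph V} (hG : IsChordalGraph G)
    {u x y : V} (hx : G.Adj u x) (hy : G.Adj u y) (hne : x ≠ y) (q : G.Walk x y)
    (hq : ∀ z ∈ q.support, z = x ∨ z = y ∨ (z ≠ u ∧ ¬ G.Adj u z)) : G.Adj x y := by
  by_contra hxy
  obtain ⟨p, hp, hpT, hch⟩ := Walk.exists_chordless_path
    (T := {z | z = x ∨ z = y ∨ (z ≠ u ∧ ¬ G.Adj u z)}) q hq
  have hu : u ∉ p.support := by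
    intro h
    rcases hpT u h with h | h | h
    · exact hx.ne h
    · exact hy.ne h
    · exact h.1 rfl
  have hlen : 2 ≤ p.length := by
    cases p with
    | nil => exact (hne rfl).elim
    | cons h p' =>
      cases p' with
      | nil => exact (hxy h).elim
      | cons h' p'' => simp
  have hcyc : (Walk.cons hx (p.concat hy.symm)).IsCycle := by
    rw [Walk.cons_isCycle_iff]
    refine ⟨hp.concat hu hy.symm, ?_⟩
    rw [Walk.edges_concat, List.concat_eq_append, List.mem_append, not_or]
    refine ⟨fun h => hu (p.fst_mem_support_of_mem_edges h), ?_⟩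
    simp only [List.mem_singleton, Sym2.eq_iff]
    rintro (⟨h, -⟩ | ⟨-, h⟩)
    · exact hy.ne h
    · exact hne h
  have hends : ∀ b ∈ p.support, G.Adj u b → s(u, b) ∈ (Walk.cons hx (p.concat hy.symm)).edges := by
    intro b hb hub
    rcases hpT b hb with rfl | rfl | h
    · simp
    · simp [Walk.edges_concat, Sym2.eq_swap]
    · exact (h.2 hub).elim
  obtain ⟨a, b, hab, ha, hb, he⟩ := hG u _ hcyc (by simp; omega)
  apply he
  have hsupp : ∀ z ∈ (Walk.cons hx (p.concat hy.symm)).support, z = u ∨ z ∈ p.support := by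
    intro z hz
    simp only [Walk.support_cons, Walk.support_concat, List.mem_cons, List.mem_append,
      List.not_mem_nil, or_false] at hz
    tauto
  rcases hsupp a ha with rfl | hap
  · rcases hsupp b hb with rfl | hbp
    · exact (hab.ne rfl).elim
    · exact hends b hbp hab
  · rcases hsupp b hb with rfl | hbp
    · rw [Sym2.eq_swap]
      exact hends a hap hab.symm
    · have := hch a hap b hbp hab
      simp [Walk.edges_concat, this]

/-- The neighbours of `v` inside `S` are pairwise adjacent. -/
def IsSimplicialIn {V : Type} (G : SimpleGraph V) (S : Set V) (v : V) : Prop :=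
  G.IsClique {x | x ∈ S ∧ G.Adj v x}

/-- Dirac: a vertex of a chordal graph that is not adjacent to all other vertices has a simplicial
non-neighbour. -/
lemma IsChordalGraph.exists_simplicial_not_adj {V : Type} {G : SimpleGraph V}
    (hG : IsChordalGraph G) (S : Finset V) {u w₀ : V} (hu : u ∈ S) (hw₀ : w₀ ∈ S)
    (hne : w₀ ≠ u) (hadj : ¬ G.Adj u w₀) :
    ∃ s ∈ S, s ≠ u ∧ ¬ G.Adj u s ∧ IsSimplicialIn G S s := by
  classical
  induction S using Finset.strongInduction generalizing u w₀ with
  | H S ih =>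
  let far : V → Prop := fun z => z ∈ S ∧ z ≠ u ∧ ¬ G.Adj u z
  let C := {w ∈ S | ∃ p : G.Walk w₀ w, ∀ z ∈ p.support, far z}
  let B := {b ∈ S | G.Adj u b ∧ ∃ c ∈ C, G.Adj b c}
  have hCfar : ∀ c ∈ C, far c := by
    intro c hc
    obtain ⟨-, p, hp⟩ := Finset.mem_filter.1 hc
    exact hp c p.end_mem_support
  have hw₀C : w₀ ∈ C := Finset.mem_filter.2
    ⟨hw₀, Walk.nil, by simpa [far] using ⟨hw₀, hne, hadj⟩⟩
  have hN : ∀ c ∈ C, ∀ z ∈ S, G.Adj c z → z ∈ C ∪ B := by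
    intro c hc z hz hcz
    rw [Finset.mem_union]
    by_cases huz : G.Adj u z
    · exact .inr (Finset.mem_filter.2 ⟨hz, huz, c, hc, hcz.symm⟩)
    · obtain ⟨-, p, hp⟩ := Finset.mem_filter.1 hc
      refine .inl (Finset.mem_filter.2 ⟨hz, p.concat hcz, fun t ht => ?_⟩)
      simp only [Walk.support_concat, List.mem_append, List.mem_singleton] at ht
      rcases ht with ht | rfl
      · exact hp t ht
      · exact ⟨hz, fun h => (hCfar c hc).2.2 (h ▸ hcz.symm), huz⟩
  have hB : G.IsClique (B : Set V) := by
    intro x hx y hy hxy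
    obtain ⟨-, hux, c, hc, hxc⟩ := Finset.mem_filter.1 hx
    obtain ⟨-, huy, d, hd, hyd⟩ := Finset.mem_filter.1 hy
    obtain ⟨-, p, hp⟩ := Finset.mem_filter.1 hc
    obtain ⟨-, q, hq⟩ := Finset.mem_filter.1 hd
    refine hG.adj_of_walk hux huy hxy
      (Walk.cons hxc (p.reverse.append (q.concat hyd.symm))) fun z hz => ?_
    simp only [Walk.support_cons, List.mem_cons, Walk.mem_support_append_iff,
      Walk.support_reverse, List.mem_reverse, Walk.support_concat, List.mem_append,
      List.not_mem_nil, or_false] at hz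
    rcases hz with h | h | h | h
    · exact .inl h
    · exact .inr (.inr (hp z h).2)
    · exact .inr (.inr (hq z h).2)
    · exact .inr (.inl h)
  have hHS : C ∪ B ⊂ S := by
    refine (Finset.ssubset_iff_of_subset
      (Finset.union_subset (Finset.filter_subset _ _) (Finset.filter_subset _ _))).2 ⟨u, hu, ?_⟩
    rw [Finset.mem_union, not_or]
    exact ⟨fun h => (hCfar u h).2.1 rfl, fun h => (Finset.mem_filter.1 h).2.1.ne rfl⟩
  suffices h : ∃ s ∈ C, IsSimplicialIn G (C ∪ B : Finset V) s by
    obtain ⟨s, hs, hsimp⟩ := h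
    refine ⟨s, (hCfar s hs).1, (hCfar s hs).2.1, (hCfar s hs).2.2, hsimp.subset ?_⟩
    rintro x ⟨hx, hsx⟩
    exact ⟨hN s hs x hx hsx, hsx⟩
  have hBpair : ∀ a ∈ B, ∀ c ∈ C ∪ B, c ≠ a → ¬ G.Adj a c →
      ∃ s ∈ C, IsSimplicialIn G (C ∪ B : Finset V) s := by
    intro a ha c hc hca hac
    obtain ⟨s, hs, hsa, has, hsimp⟩ :=
      ih _ hHS (Finset.mem_union_right _ ha) hc hca hac
    rcases Finset.mem_union.1 hs with h | h
    · exact ⟨s, h, hsimp⟩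
    · exact (has (hB ha h hsa.symm)).elim
  by_cases hcomp : ∀ a ∈ C ∪ B, ∀ c ∈ C ∪ B, c ≠ a → G.Adj a c
  · exact ⟨w₀, hw₀C, fun x hx y hy hxy => hcomp x hx.1 y hy.1 hxy.symm⟩
  · push Not at hcomp
    obtain ⟨a, ha, c, hc, hca, hac⟩ := hcomp
    obtain ⟨s, hs, hsa, has, hsimp⟩ := ih _ hHS ha hc hca hac
    rcases Finset.mem_union.1 hs with h | h
    · exact ⟨s, h, hsimp⟩
    · exact hBpair s h a ha hsa.symm fun h => has h.symm

lemma IsChordalGraph.exists_simplicial {V : Type} {G : SimpleGraph V} (hG : IsChordalGraph G)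
    {S : Finset V} (hS : S.Nonempty) : ∃ s ∈ S, IsSimplicialIn G S s := by
  by_cases hcomp : ∀ a ∈ S, ∀ c ∈ S, c ≠ a → G.Adj a c
  · obtain ⟨w, hw⟩ := hS
    exact ⟨w, hw, fun x hx y hy hxy => hcomp x hx.1 y hy.1 hxy.symm⟩
  · push Not at hcomp
    obtain ⟨a, ha, c, hc, hca, hac⟩ := hcomp
    obtain ⟨s, hs, -, -, hsimp⟩ := hG.exists_simplicial_not_adj S ha hc hca hac
    exact ⟨s, hs, hsimp⟩

/-- The inclusion-maximal cliques of `G` contained in `S`. -/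
def maxCliquesIn {V : Type} (G : SimpleGraph V) (S : Finset V) : Set (Finset V) :=
  {F | Maximal (fun K : Finset V => K ⊆ S ∧ G.IsClique (K : Set V)) F}

lemma mem_maxCliquesIn {V : Type} {G : SimpleGraph V} {S F : Finset V} :
    F ∈ maxCliquesIn G S ↔ Maximal (fun K : Finset V => K ⊆ S ∧ G.IsClique (K : Set V)) F :=
  Iff.rfl

lemma exists_mem_maxCliquesIn {V : Type} {G : SimpleGraph V} {S K : Finset V} (hK : K ⊆ S)
    (hc : G.IsClique (K : Set V)) : ∃ F ∈ maxCliquesIn G S, K ⊆ F := by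
  have hfin : {K : Finset V | K ⊆ S ∧ G.IsClique (K : Set V)}.Finite :=
    S.powerset.finite_toSet.subset fun F hF => by simpa using hF.1
  obtain ⟨F, hKF, hF⟩ := hfin.exists_le_maximal (a := K) ⟨hK, hc⟩
  exact ⟨F, hF, hKF⟩

section Simplicial

variable {V : Type} [DecidableEq V] {G : SimpleGraph V} [DecidableRel G.Adj] {S : Finset V} {v : V}

lemma subset_insert_filter_adj {K : Finset V} (hK : K ⊆ S) (hc : G.IsClique (K : Set V))
    (hv : v ∈ K) : K ⊆ insert v {x ∈ S | G.Adj v x} := by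
  intro x hx
  rw [Finset.mem_insert, Finset.mem_filter]
  by_cases h : x = v
  · exact .inl h
  · exact .inr ⟨hK hx, hc hv hx (Ne.symm h)⟩

lemma maxCliquesIn_eq_of_simplicial (hv : v ∈ S) (hs : IsSimplicialIn G S v) :
    maxCliquesIn G S = insert (insert v {x ∈ S | G.Adj v x})
      (maxCliquesIn G (S.erase v) \ {{x ∈ S | G.Adj v x}}) := by
  set N := {x ∈ S | G.Adj v x} with hNdef
  have hvN : v ∉ N := by simp [hNdef]
  have hNS : N ⊆ S.erase v := fun x hx =>
    Finset.mem_erase.2 ⟨fun h => hvN (h ▸ hx), (Finset.mem_filter.1 hx).1⟩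
  have hNc : G.IsClique (N : Set V) := by simpa [IsSimplicialIn, hNdef] using hs
  have hNS' : insert v N ⊆ S := Finset.insert_subset hv (hNS.trans (Finset.erase_subset _ _))
  have hNc' : G.IsClique (insert v N : Finset V) := by
    rw [Finset.coe_insert]
    exact hNc.insert fun b hb _ => (Finset.mem_filter.1 hb).2
  ext F
  rw [Set.mem_insert_iff, Set.mem_sdiff, Set.mem_singleton_iff]
  constructor
  · intro hF
    by_cases hvF : v ∈ F
    · exact .inl ((mem_maxCliquesIn.1 hF).eq_of_le ⟨hNS', hNc'⟩ (subset_insert_filter_adj hF.1.1 hF.1.2 hvF))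
    · refine .inr ⟨⟨⟨Finset.subset_erase.2 ⟨hF.1.1, hvF⟩, hF.1.2⟩, fun K hK hFK =>
        hF.2 ⟨hK.1.trans (Finset.erase_subset _ _), hK.2⟩ hFK⟩, ?_⟩
      rintro rfl
      exact hvN (hF.2 ⟨hNS', hNc'⟩ (Finset.subset_insert _ _) (Finset.mem_insert_self _ _))
  · rintro (rfl | ⟨hF, hFN⟩)
    · exact ⟨⟨hNS', hNc'⟩, fun K hK hNK =>
        subset_insert_filter_adj hK.1 hK.2 (hNK (Finset.mem_insert_self _ _))⟩
    · refine ⟨⟨hF.1.1.trans (Finset.erase_subset _ _), hF.1.2⟩, fun K hK hFK => ?_⟩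
      by_cases hvK : v ∈ K
      · refine (hFN ((mem_maxCliquesIn.1 hF).eq_of_le ⟨hNS, hNc⟩ fun x hx => ?_)).elim
        rcases Finset.mem_insert.1 (subset_insert_filter_adj hK.1 hK.2 hvK (hFK hx)) with rfl | h
        · exact (Finset.notMem_erase x S (hF.1.1 hx)).elim
        · exact h
      · exact hF.2 ⟨Finset.subset_erase.2 ⟨hK.1, hvK⟩, hK.2⟩ hFK

end Simplicial

/-- Every set of the list but the first has a branch among its predecessors. -/
def IsLeafOrder {V : Type} [DecidableEq V] (L : List (Finset V)) : Prop :=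
  ∀ i (hi : i < L.length), i = 0 ∨
    ∃ j, ∃ hj : j < i, ∀ k (hk : k < i), L[k] ∩ L[i] ⊆ L[j]

section LeafOrder

variable {V : Type} [DecidableEq V] {L : List (Finset V)}

lemma IsLeafOrder.append_singleton (hL : IsLeafOrder L) {F B : Finset V} (hB : B ∈ L)
    (hF : ∀ H ∈ L, H ∩ F ⊆ B) : IsLeafOrder (L ++ [F]) := by
  intro i hi
  rw [List.length_append, List.length_singleton] at hi
  rcases Nat.lt_succ_iff_lt_or_eq.1 hi with hi | hi
  · refine (hL i hi).imp_right ?_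
    rintro ⟨j, hj, h⟩
    refine ⟨j, hj, fun k hk => ?_⟩
    rw [List.getElem_append_left (by omega), List.getElem_append_left (by omega),
      List.getElem_append_left (by omega)]
    exact h k hk
  · subst hi
    obtain ⟨j, hj, rfl⟩ := List.mem_iff_getElem.1 hB
    refine .inr ⟨j, hj, fun k hk => ?_⟩
    rw [List.getElem_append_left hk, List.getElem_append_left hj,
      List.getElem_append_right le_rfl]
    simpa using hF L[k] (List.getElem_mem _)

lemma IsLeafOrder.map_insert (hL : IsLeafOrder L) (hnd : L.Nodup) {v : V}
    (hv : ∀ F ∈ L, v ∉ F) (N : Finset V) :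
    IsLeafOrder (L.map fun F => if F = N then insert v F else F) := by
  intro i hi
  rw [List.length_map] at hi
  refine (hL i hi).imp_right ?_
  rintro ⟨j, hj, h⟩
  refine ⟨j, hj, fun k hk => ?_⟩
  have hne : L[k] ≠ L[i] := fun h => by
    have := (hnd.getElem_inj_iff).1 h
    omega
  have hvk := hv L[k] (List.getElem_mem _)
  have hvi := hv L[i] (List.getElem_mem _)
  have hk' := h k hk
  simp only [List.getElem_map]
  intro x hx
  have hxj : x ∈ L[j] := by
    apply hk'
    rw [Finset.mem_inter] at hx ⊢
    grind
  split_ifs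
  · exact Finset.mem_insert_of_mem hxj
  · exact hxj

end LeafOrder

lemma IsChordalGraph.exists_isLeafOrder {V : Type} [DecidableEq V] {G : SimpleGraph V}
    (hG : IsChordalGraph G) (S : Finset V) :
    ∃ L : List (Finset V), L.Nodup ∧ {F | F ∈ L} = maxCliquesIn G S ∧ IsLeafOrder L := by
  classical
  induction S using Finset.strongInduction with
  | H S ih =>
  rcases S.eq_empty_or_nonempty with rfl | hS
  · refine ⟨[∅], by simp, ?_, fun i hi => .inl (by simpa using hi)⟩
    ext F
    simp only [List.mem_singleton, Set.mem_ofPred_eq, maxCliquesIn]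
    constructor
    · rintro rfl
      exact ⟨by simp, fun K hK _ => hK.1⟩
    · exact fun h => Finset.subset_empty.1 h.1.1
  obtain ⟨v, hv, hs⟩ := hG.exists_simplicial hS
  obtain ⟨L, hnd, hmem, hL⟩ := ih _ (Finset.erase_ssubset hv)
  have hmax := maxCliquesIn_eq_of_simplicial hv hs
  set N := {x ∈ S | G.Adj v x} with hNdef
  have hvN : v ∉ N := by simp [hNdef]
  have hNS : N ⊆ S.erase v := fun x hx =>
    Finset.mem_erase.2 ⟨fun h => hvN (h ▸ hx), (Finset.mem_filter.1 hx).1⟩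
  have hNc : G.IsClique (N : Set V) := by simpa [IsSimplicialIn, hNdef] using hs
  have hvL : ∀ F ∈ L, v ∉ F := by
    intro F hF hvF
    have hF' : F ∈ maxCliquesIn G (S.erase v) := hmem ▸ hF
    exact Finset.notMem_erase v S (hF'.1.1 hvF)
  rw [← hmem] at hmax
  by_cases hN : N ∈ L
  · refine ⟨_, ?_, ?_, hL.map_insert hnd hvL N⟩
    · refine List.Nodup.map_on (fun F hF K hK h => ?_) hnd
      have := hvL F hF
      have := hvL K hK
      grind
    · rw [hmax]
      ext F
      simp only [List.mem_map, Set.mem_ofPred_eq, Set.mem_insert_iff, Set.mem_sdiff,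
        Set.mem_singleton_iff]
      grind
  · obtain ⟨B, hB, hNB⟩ := exists_mem_maxCliquesIn hNS hNc
    rw [← hmem] at hB
    refine ⟨L ++ [insert v N], ?_, ?_, hL.append_singleton hB fun H hH x hx => hNB ?_⟩
    · rw [List.nodup_append_comm, List.singleton_append, List.nodup_cons]
      exact ⟨fun h => hvL _ h (Finset.mem_insert_self _ _), hnd⟩
    · rw [hmax]
      ext F
      simp only [List.mem_append, List.mem_singleton, Set.mem_ofPred_eq, Set.mem_insert_iff,
        Set.mem_sdiff, Set.mem_singleton_iff]
      grind
    · rw [Finset.mem_inter, Finset.mem_insert] at hx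
      rcases hx with ⟨hxH, rfl | hxN⟩
      · exact (hvL H hH hxH).elim
      · exact hxN

section Facets

variable {n : ℕ}

lemma facets_gen_s12 {T : Set (Finset (Fin n))} (hT : IsAntichain (· ⊆ ·) T) :
    facets (gen T) = T := by
  ext F
  constructor
  · rintro ⟨⟨K, hK, hFK⟩, h⟩
    rwa [h K ⟨K, hK, subset_rfl⟩ hFK]
  · refine fun hF => ⟨⟨F, hF, subset_rfl⟩, ?_⟩
    rintro H ⟨K, hK, hHK⟩ hFH
    have := hT.eq hF hK (hFH.trans hHK)
    subst this
    exact hFH.antisymm hHK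

lemma isAntichain_facets (Δ : Set (Finset (Fin n))) : IsAntichain (· ⊆ ·) (facets Δ) :=
  fun _ hF _ hK hne h => hne (hF.2 _ hK.1 h)

lemma isLeafOrder_iff {L : List (Finset (Fin n))} (hnd : L.Nodup)
    (hL : IsAntichain (· ⊆ ·) {F | F ∈ L}) :
    (∀ i : Fin L.length, IsLeaf (gen {F | F ∈ L.take (i.1 + 1)}) (L.get i)) ↔
      IsLeafOrder L := by
  have hfac : ∀ i, facets (gen {F | F ∈ L.take (i + 1)}) = {F | F ∈ L.take (i + 1)} :=
    fun i => facets_gen_s12 (hL.subset fun F hF => List.mem_of_mem_take hF)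
  have hget : ∀ i k (hi : i < L.length) (hk : k < i + 1), L[k] ∈ L.take (i + 1) :=
    fun i k hi hk => List.mem_take_iff_getElem.2 ⟨k, by omega, rfl⟩
  have hlt : ∀ i (hi : i < L.length), ∀ F ∈ L.take (i + 1), F ≠ L[i] →
      ∃ k, ∃ hk : k < i, L[k] = F := by
    intro i hi F hF hne
    obtain ⟨k, hk, rfl⟩ := List.mem_take_iff_getElem.1 hF
    refine ⟨k, lt_of_le_of_ne (by omega) ?_, rfl⟩
    rintro rfl
    exact hne rfl
  have hne : ∀ i k (hi : i < L.length) (hk : k < i), L[k] ≠ L[i] := fun i k hi hk h => by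
    have := (hnd.getElem_inj_iff).1 h
    omega
  constructor
  · intro h i hi
    obtain ⟨-, h | ⟨B, hB, hBi, h⟩⟩ := h ⟨i, hi⟩
    · left
      by_contra h0
      have hmem : L[0] ∈ facets (gen {F | F ∈ L.take (i + 1)}) := by
        rw [hfac]
        exact hget i 0 hi (by omega)
      simp only [h] at hmem
      exact hne i 0 hi (by omega) hmem
    · right
      rw [hfac] at hB h
      obtain ⟨j, hj, rfl⟩ := hlt i hi B hB hBi
      exact ⟨j, hj, fun k hk =>
        (h L[k] (hget i k hi (by omega)) (hne i k hi hk)).trans Finset.inter_subset_left⟩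
  · rintro h ⟨i, hi⟩
    have hmem := hget i i hi (by omega)
    rw [IsLeaf, hfac]
    refine ⟨hmem, ?_⟩
    rcases h i hi with rfl | ⟨j, hj, h⟩
    · left
      ext F
      refine ⟨fun hF => ?_, fun hF => ?_⟩
      · by_contra hFne
        obtain ⟨k, hk, -⟩ := hlt 0 hi F hF hFne
        omega
      · rw [Set.mem_singleton_iff.1 hF]
        exact hmem
    · refine .inr ⟨L[j], hget i j hi (by omega), hne i j hi hj, fun H hH hHne => ?_⟩
      obtain ⟨k, hk, rfl⟩ := hlt i hi H hH hHne
      exact Finset.subset_inter (h k hk) Finset.inter_subset_right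

lemma facets_cliqueComplex (G : SimpleGraph (Fin n)) :
    facets (cliqueComplex G) = maxCliquesIn G Finset.univ := by
  ext F
  constructor
  · exact fun h => ⟨⟨Finset.subset_univ _, h.1⟩, fun K hK hFK => (h.2 K hK.2 hFK).ge⟩
  · exact fun h => ⟨h.1.2, fun K hK hFK => (mem_maxCliquesIn.1 h).eq_of_le ⟨Finset.subset_univ _, hK⟩ hFK⟩

lemma isQuasiTree_iff {Δ : Set (Finset (Fin n))} :
    IsQuasiTree Δ ↔ ∃ L : List (Finset (Fin n)),
      L.Nodup ∧ {F | F ∈ L} = facets Δ ∧ IsLeafOrder L := by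
  refine exists_congr fun L => and_congr_right fun hnd => and_congr_right fun hL => ?_
  exact isLeafOrder_iff hnd (hL ▸ isAntichain_facets Δ)

end Facets

lemma IsLeafOrder.isChordalGraph {V : Type} [DecidableEq V] {G : SimpleGraph V}
    {L : List (Finset V)} (hL : IsLeafOrder L) (hclique : ∀ F ∈ L, G.IsClique (F : Set V))
    (hedge : ∀ x y, G.Adj x y → ∃ F ∈ L, x ∈ F ∧ y ∈ F) : IsChordalGraph G := by
  classical
  intro v c hc hlen
  by_contra! hch
  let covered : ℕ → Prop := fun i =>
    ∀ x y, s(x, y) ∈ c.edges → ∃ k, ∃ hk : k < L.length, k < i ∧ x ∈ L[k] ∧ y ∈ L[k]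
  have hex : ∃ i, covered i := by
    refine ⟨L.length, fun x y hxy => ?_⟩
    obtain ⟨F, hF, hx, hy⟩ := hedge x y (c.adj_of_mem_edges hxy)
    obtain ⟨k, hk, rfl⟩ := List.mem_iff_getElem.1 hF
    exact ⟨k, hk, hk, hx, hy⟩
  -- `m` is the least index such that the first `m` facets cover the edges of the cycle.
  obtain ⟨m, hm, hmin⟩ : ∃ m, covered m ∧ ∀ j < m, ¬ covered j :=
    ⟨Nat.find hex, Nat.find_spec hex, fun j hj => Nat.find_min hex hj⟩
  have hedge₀ : ∃ x y, s(x, y) ∈ c.edges :=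
    ⟨_, _, c.mk_mem_edges_iff_exists.2 ⟨0, by omega, rfl⟩⟩
  obtain ⟨i, rfl⟩ : ∃ i, m = i + 1 := by
    obtain ⟨x, y, hxy⟩ := hedge₀
    obtain ⟨k, -, hk, -⟩ := hm x y hxy
    exact ⟨m - 1, by omega⟩
  have hnot := hmin i (by omega)
  simp only [covered] at hnot
  push Not at hnot
  obtain ⟨x, y, hxy, hlast⟩ := hnot
  obtain ⟨hi, hx, hy⟩ : ∃ hi : i < L.length, x ∈ L[i] ∧ y ∈ L[i] := by
    obtain ⟨k, hk, hki, hx, hy⟩ := hm x y hxy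
    have : k = i := by
      by_contra h
      exact hlast k hk (by omega) hx hy
    subst this
    exact ⟨hk, hx, hy⟩
  -- The cycle leaves `L[i]` at both ends of the edge `s(x, y)`, through earlier facets.
  have hearlier : ∀ a b, s(a, b) ∈ c.edges → a ∈ L[i] → b ∈ L[i] →
      ∃ k, ∃ hk : k < i, b ∈ L[k] := by
    intro a b hab ha hb
    obtain ⟨z, hbz, hza, haz⟩ := hc.exists_next_edge hlen hab
    have hz : z ∉ L[i] := fun hz =>
      haz (hch a z (hclique _ (List.getElem_mem _) ha hz hza.symm)
        (c.fst_mem_support_of_mem_edges hab) (c.snd_mem_support_of_mem_edges hbz))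
    obtain ⟨k, hk, hki, hbk, hzk⟩ := hm b z hbz
    refine ⟨k, lt_of_le_of_ne (by omega) ?_, hbk⟩
    rintro rfl
    exact hz hzk
  obtain ⟨k, hk, hyk⟩ := hearlier x y hxy hx hy
  obtain ⟨l, hl, hxl⟩ := hearlier y x (Sym2.eq_swap ▸ hxy) hy hx
  rcases hL i hi with rfl | ⟨j, hj, h⟩
  · omega
  · exact hlast j (by omega) hj (h l hl (Finset.mem_inter.2 ⟨hxl, hx⟩))
      (h k hk (Finset.mem_inter.2 ⟨hyk, hy⟩))

/-- For a finite simple graph `G` on `[n]`, the clique complex `Δ(G)` is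
a quasi-tree if and only if `G` is chordal. -/
theorem stmt_12 {n : ℕ} (G : SimpleGraph (Fin n)) :
    IsQuasiTree (cliqueComplex G) ↔ IsChordalGraph G := by
  rw [isQuasiTree_iff, facets_cliqueComplex]
  constructor
  · rintro ⟨L, -, hmem, hL⟩
    have hmem' : ∀ F, F ∈ L ↔ F ∈ maxCliquesIn G Finset.univ := fun F => by
      rw [← hmem, Set.mem_ofPred_eq]
    refine hL.isChordalGraph (fun F hF => ((hmem' F).1 hF).1.2) fun x y hxy => ?_
    obtain ⟨F, hF, hsub⟩ := exists_mem_maxCliquesIn (G := G) (Finset.subset_univ {x, y})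
      (by simpa using fun _ => hxy)
    exact ⟨F, (hmem' F).2 hF, hsub (by simp), hsub (by simp)⟩
  · exact fun hG => hG.exists_isLeafOrder Finset.univ
end
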